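/- arXiv:1504.06298 — 2 statements merged into one kernel-verified Lean document; each statement's English description precedes it below -/
import Mathlib

section
/- Let f be convex with L_f-Lipschitz continuous gradient on X and quasi-strongly convex on X with constant κ_f > 0, and let μ_f = κ_f/L_f with 0 < μ_f < 1. The projected gradient iterates x^{k+1} = [x^k − (1/L_f)∇f(x^k)]_X, started from x^0 ∈ X, satisfy for all k ≥ 1 the linear convergence rate in function values f(x^k) − f* ≤ (L_f‖x^0 − [x^0]_{X*}‖²/2)·μ_f/((1 − μ_f)^{−k} − 1). -/
open Set
open scoped InnerProductSpace

section ProjectedGradient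

variable {E : Type*} [NormedAddCommGroup E] [InnerProductSpace ℝ E]

/-- Variational characterization of a nearest point of a convex set. -/
lemma inner_sub_nearest_point_le_zero {K : Set E} (hK : Convex ℝ K) {u p : E} (hp : p ∈ K)
    (hmin : ∀ y ∈ K, ‖u - p‖ ≤ ‖u - y‖) {y : E} (hy : y ∈ K) : ⟪u - p, y - p⟫_ℝ ≤ 0 := by
  refine (norm_eq_iInf_iff_real_inner_le_zero hK hp).1 ?_ y hy
  have : Nonempty K := ⟨⟨p, hp⟩⟩
  refine le_antisymm (le_ciInf fun w => hmin w w.2) ?_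
  exact ciInf_le (f := fun w : K => ‖u - w‖)
    ⟨0, by rintro _ ⟨w, rfl⟩; exact norm_nonneg _⟩ ⟨p, hp⟩

/-- Descent lemma for a function whose gradient is Lipschitz continuous on a convex set. -/
lemma le_quadratic_of_gradient_lipschitz_on_convex [CompleteSpace E] {K : Set E}
    (hK : Convex ℝ K) {f : E → ℝ} {f' : E → E} {L : ℝ} (hgrad : ∀ x, HasGradientAt f (f' x) x)
    (hLip : ∀ x ∈ K, ∀ y ∈ K, ‖f' x - f' y‖ ≤ L * ‖x - y‖) {x y : E} (hx : x ∈ K)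
    (hy : y ∈ K) : f y ≤ f x + ⟪f' x, y - x⟫_ℝ + L / 2 * ‖y - x‖ ^ 2 := by
  set d := y - x with hd
  let φ : ℝ → ℝ := fun t => f (x + t • d) - t * ⟪f' x, d⟫_ℝ - L / 2 * ‖d‖ ^ 2 * t ^ 2
  have hφ : ∀ t, HasDerivAt φ (⟪f' (x + t • d), d⟫_ℝ - ⟪f' x, d⟫_ℝ - L * ‖d‖ ^ 2 * t) t := by
    intro t
    have hline : HasDerivAt (fun t : ℝ => x + t • d) d t := by
      simpa using ((hasDerivAt_id t).smul_const d).const_add x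
    have hf : HasDerivAt (fun t : ℝ => f (x + t • d)) ⟪f' (x + t • d), d⟫_ℝ t := by
      simpa [Function.comp_def] using
        (hgrad (x + t • d)).hasFDerivAt.comp_hasDerivAt t hline
    have hlin : HasDerivAt (fun t : ℝ => t * ⟪f' x, d⟫_ℝ) ⟪f' x, d⟫_ℝ t := by
      simpa using (hasDerivAt_id t).mul_const ⟪f' x, d⟫_ℝ
    have hsq := (hasDerivAt_pow 2 t).const_mul (L / 2 * ‖d‖ ^ 2)
    refine ((hf.sub hlin).sub hsq).congr_deriv ?_
    norm_num
    ring
  have hanti : AntitoneOn φ (Icc 0 1) := by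
    refine antitoneOn_of_deriv_nonpos (convex_Icc 0 1)
      (fun t _ => (hφ t).continuousAt.continuousWithinAt)
      (fun t _ => (hφ t).differentiableAt.differentiableWithinAt) fun t ht => ?_
    rw [interior_Icc] at ht
    rw [(hφ t).deriv]
    have hmem : x + t • d ∈ K := hK.add_smul_sub_mem hx hy ⟨ht.1.le, ht.2.le⟩
    have hdiff := hLip _ hmem x hx
    rw [add_sub_cancel_left, norm_smul, Real.norm_of_nonneg ht.1.le] at hdiff
    have hcs := real_inner_le_norm (f' (x + t • d) - f' x) d
    rw [inner_sub_left] at hcs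
    nlinarith [mul_le_mul_of_nonneg_right hdiff (norm_nonneg d)]
  have h01 := hanti (left_mem_Icc.2 zero_le_one) (right_mem_Icc.2 zero_le_one) zero_le_one
  simp only [φ, one_smul, zero_smul, add_zero, hd, add_sub_cancel] at h01
  linarith

/-- Three-point inequality for one projected gradient step with stepsize `1 / L`. -/
lemma projected_gradient_step_le [CompleteSpace E] {K : Set E} (hK : Convex ℝ K) {f : E → ℝ}
    {f' : E → E} {L : ℝ} (hL : 0 < L) (hgrad : ∀ x, HasGradientAt f (f' x) x)
    (hLip : ∀ x ∈ K, ∀ y ∈ K, ‖f' x - f' y‖ ≤ L * ‖x - y‖) {x p y : E} (hx : x ∈ K)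
    (hp : p ∈ K) (hmin : ∀ z ∈ K, ‖x - (1 / L) • f' x - p‖ ≤ ‖x - (1 / L) • f' x - z‖)
    (hy : y ∈ K) :
    f p ≤ f x + ⟪f' x, y - x⟫_ℝ + L / 2 * ‖x - y‖ ^ 2 - L / 2 * ‖p - y‖ ^ 2 := by
  have hdesc := le_quadratic_of_gradient_lipschitz_on_convex hK hgrad hLip hx hp
  have hvar := inner_sub_nearest_point_le_zero hK hp hmin hy
  have hsplit : x - (1 / L) • f' x - p = (x - p) - (1 / L) • f' x := by abel
  rw [hsplit, inner_sub_left, real_inner_smul_left] at hvar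
  have hvar' : L * ⟪x - p, y - p⟫_ℝ ≤ ⟪f' x, y - p⟫_ℝ := by
    have := mul_le_mul_of_nonneg_left hvar hL.le
    rw [mul_sub, mul_zero, ← mul_assoc, mul_one_div_cancel hL.ne', one_mul] at this
    linarith
  have hlin : ⟪f' x, y - x⟫_ℝ = ⟪f' x, p - x⟫_ℝ + ⟪f' x, y - p⟫_ℝ := by
    rw [← inner_add_right]
    congr 1
    abel
  have hexp : ‖x - y‖ ^ 2 = ‖x - p‖ ^ 2 - 2 * ⟪x - p, y - p⟫_ℝ + ‖y - p‖ ^ 2 := by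
    rw [← norm_sub_sq_real, sub_sub_sub_cancel_right]
  rw [norm_sub_rev p x] at hdesc
  rw [norm_sub_rev p y, hexp]
  linarith

end ProjectedGradient

/-- Linear convergence in function values of the projected gradient method for
quasi-strongly convex functions: f(xᵏ) - f* ≤ (Lf‖x⁰ - x̄⁰‖²/2)·μ/((1-μ)⁻ᵏ - 1). -/
theorem gm_linear_convergence_function_values_quasi_strong_convex
    {n : ℕ} (X Xstar : Set (EuclideanSpace ℝ (Fin n)))
    (f : EuclideanSpace ℝ (Fin n) → ℝ)
    (f' proj projX : EuclideanSpace ℝ (Fin n) → EuclideanSpace ℝ (Fin n))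
    (fstar Lf κ : ℝ)
    -- X is a nonempty closed convex set
    (hXne : X.Nonempty) (hXclosed : IsClosed X) (hXconv : Convex ℝ X)
    -- f is convex and continuously differentiable, with gradient f'
    (hconv : ConvexOn ℝ univ f)
    (hsmooth : ContDiff ℝ 1 f)
    (hgrad : ∀ x, HasGradientAt f (f' x) x)
    -- the gradient of f is Lipschitz continuous on X with constant Lf > 0
    (hLf : 0 < Lf)
    (hLip : ∀ x ∈ X, ∀ y ∈ X, ‖f' x - f' y‖ ≤ Lf * ‖x - y‖)
    -- Xstar is the (nonempty, closed) set of minimizers of f over X, with optimal value fstar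
    (hXstar : Xstar = {x ∈ X | ∀ y ∈ X, f x ≤ f y})
    (hXstar_ne : Xstar.Nonempty) (hXstar_closed : IsClosed Xstar)
    (hfstar : ∀ x ∈ Xstar, f x = fstar)
    -- proj is the Euclidean projection onto Xstar
    (hproj : ∀ x, proj x ∈ Xstar ∧ ∀ y ∈ Xstar, ‖x - proj x‖ ≤ ‖x - y‖)
    -- projX is the Euclidean projection onto X
    (hprojX : ∀ u, projX u ∈ X ∧ ∀ y ∈ X, ‖u - projX u‖ ≤ ‖u - y‖)
    (hκ : 0 < κ)
    -- f is quasi-strongly convex on X with constant κ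
    (hqsc : ∀ x ∈ X, fstar ≥ f x + ⟪f' x, proj x - x⟫_ℝ + κ / 2 * ‖x - proj x‖ ^ 2)
    -- condition number μ = κ/Lf lies in (0, 1)
    (hμ : κ / Lf < 1)
    -- projected gradient iterates with constant stepsize 1/Lf, started from x⁰ ∈ X
    (x : ℕ → EuclideanSpace ℝ (Fin n))
    (hx0 : x 0 ∈ X)
    (hiter : ∀ k, x (k + 1) = projX (x k - (1 / Lf) • f' (x k)))
    :
    ∀ k : ℕ, 1 ≤ k → f (x k) - fstar ≤
      Lf * ‖x 0 - proj (x 0)‖ ^ 2 / 2 *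
        ((κ / Lf) / ((1 - κ / Lf) ^ (-(k : ℤ)) - 1)) := by
  set q : ℝ := 1 - κ / Lf with hq
  have hμ0 : 0 < κ / Lf := div_pos hκ hLf
  have hq0 : 0 < q := by linarith
  have hq1 : q < 1 := by linarith
  have hsub : ∀ z ∈ Xstar, z ∈ X ∧ ∀ y ∈ X, f z ≤ f y := fun z hz => by
    rw [hXstar] at hz
    exact hz
  have hmem : ∀ k, x k ∈ X := by
    rintro (_ | k)
    · exact hx0
    · rw [hiter]
      exact (hprojX _).1
  have hstep : ∀ k, ∀ y ∈ X, f (x (k + 1)) ≤ f (x k) + ⟪f' (x k), y - x k⟫_ℝ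
      + Lf / 2 * ‖x k - y‖ ^ 2 - Lf / 2 * ‖x (k + 1) - y‖ ^ 2 := fun k y hy => by
    refine projected_gradient_step_le hXconv hLf hgrad hLip (hmem k) (hmem (k + 1)) ?_ hy
    rw [hiter]
    exact (hprojX _).2
  have hmono : ∀ k, f (x (k + 1)) ≤ f (x k) := fun k => by
    have := hstep k (x k) (hmem k)
    simp only [sub_self, inner_zero_right, norm_zero] at this
    nlinarith [mul_nonneg hLf.le (sq_nonneg ‖x (k + 1) - x k‖)]
  have hcontr : ∀ k, f (x (k + 1)) - fstar + Lf / 2 * ‖x (k + 1) - proj (x (k + 1))‖ ^ 2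
      ≤ q * (Lf / 2 * ‖x k - proj (x k)‖ ^ 2) := fun k => by
    have h1 := hstep k _ (hsub _ (hproj (x k)).1).1
    have h2 := hqsc _ (hmem k)
    have h3 : ‖x (k + 1) - proj (x (k + 1))‖ ^ 2 ≤ ‖x (k + 1) - proj (x k)‖ ^ 2 :=
      pow_le_pow_left₀ (norm_nonneg _) ((hproj (x (k + 1))).2 _ (hproj (x k)).1) 2
    have h4 := mul_le_mul_of_nonneg_left h3 (half_pos hLf).le
    have h5 : q * (Lf / 2 * ‖x k - proj (x k)‖ ^ 2)
        = Lf / 2 * ‖x k - proj (x k)‖ ^ 2 - κ / 2 * ‖x k - proj (x k)‖ ^ 2 := by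
      rw [hq]
      field_simp
    linarith
  have hsum : ∀ k, κ / Lf * (Lf / 2 * ‖x k - proj (x k)‖ ^ 2) + (f (x k) - fstar) * (1 - q ^ k)
      ≤ κ / Lf * (q ^ k * (Lf / 2 * ‖x 0 - proj (x 0)‖ ^ 2)) := by
    intro k
    induction k with
    | zero => simp
    | succ k ih =>
      have hqk : 0 ≤ q * (1 - q ^ k) :=
        mul_nonneg hq0.le (sub_nonneg.2 (pow_le_one₀ hq0.le hq1.le))
      have h1 := mul_le_mul_of_nonneg_left (hcontr k) hμ0.le
      have h2 := mul_le_mul_of_nonneg_left ih hq0.le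
      have h3 := mul_le_mul_of_nonneg_right (hmono k) hqk
      have h4 : 1 - q ^ (k + 1) = κ / Lf + q * (1 - q ^ k) := by
        rw [pow_succ, hq]
        ring
      rw [h4, pow_succ q]
      linarith
  intro k hk
  have hqk0 : 0 < q ^ k := pow_pos hq0 k
  have hqk1 : q ^ k < 1 := pow_lt_one₀ hq0.le hq1 (by omega)
  have hrate : κ / Lf / (q ^ (-(k : ℤ)) - 1) = κ / Lf * q ^ k / (1 - q ^ k) := by
    have hinv : (q ^ k)⁻¹ - 1 = (1 - q ^ k) / q ^ k := by field_simp
    rw [zpow_neg, zpow_natCast, hinv, div_div_eq_mul_div]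
  rw [hrate, ← mul_div_assoc, le_div_iff₀ (sub_pos.2 hqk1)]
  have hdist : 0 ≤ κ / Lf * (Lf / 2 * ‖x k - proj (x k)‖ ^ 2) := by positivity
  linarith [hsum k]
end

section
/- Let f be convex with L_f-Lipschitz continuous gradient on X and satisfy the quadratic functional growth condition on X with constant κ_f > 0. Let L̄_f ≥ L_f, β ≥ 0, L > 0, and consider a feasible descent sequence: x^0 ∈ X and for each k, x^{k+1} = [x^k − α_k∇f(x^k) + e^k]_X with stepsize α_k ≥ 1/L̄_f, error satisfying ‖e^k‖ ≤ β‖x^{k+1} − x^k‖, and sufficient decrease f(x^{k+1}) ≤ f(x^k) − (L/2)‖x^{k+1} − x^k‖². Then for all k ≥ 0, f(x^k) − f* ≤ (1/(1 + Lκ_f/(4(L_f + L̄_f + βL̄_f)²)))^k·(f(x^0) − f*). -/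
open Set
open scoped InnerProductSpace

/-- The first-order lower bound for a convex function with a gradient. -/
theorem ConvexOn.add_inner_gradient_le {E : Type*} [NormedAddCommGroup E] [InnerProductSpace ℝ E]
    [CompleteSpace E] {f : E → ℝ} {g y : E} (hf : ConvexOn ℝ univ f) (hg : HasGradientAt f g y)
    (z : E) : f y + ⟪g, z - y⟫_ℝ ≤ f z := by
  have hline : HasDerivAt (fun t : ℝ => f (AffineMap.lineMap y z t)) ⟪g, z - y⟫_ℝ 0 := by
    have hl : HasDerivAt (fun t : ℝ => AffineMap.lineMap y z t) (z - y) (0 : ℝ) :=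
      AffineMap.hasDerivAt_lineMap
    have hg' : HasFDerivAt f (InnerProductSpace.toDual ℝ E g) (AffineMap.lineMap y z (0 : ℝ)) := by
      simpa using hg.hasFDerivAt
    simpa [Function.comp_def] using hg'.comp_hasDerivAt (0 : ℝ) hl
  have hc : ConvexOn ℝ univ (fun t : ℝ => f (AffineMap.lineMap y z t)) := by
    simpa [Function.comp_def] using hf.comp_affineMap (AffineMap.lineMap y z : ℝ →ᵃ[ℝ] E)
  have := hc.le_slope_of_hasDerivAt (mem_univ (0 : ℝ)) (mem_univ 1) one_pos hline
  simp [slope_def_field] at this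
  linarith

/-- The variational inequality characterizing a nearest point of a convex set. -/
theorem Convex.inner_sub_nearest_nonpos {E : Type*} [NormedAddCommGroup E] [InnerProductSpace ℝ E]
    {K : Set E} (hK : Convex ℝ K) {u v w : E} (hv : v ∈ K) (hmin : ∀ y ∈ K, ‖u - v‖ ≤ ‖u - y‖)
    (hw : w ∈ K) : ⟪u - v, w - v⟫_ℝ ≤ 0 := by
  have : Nonempty K := ⟨⟨v, hv⟩⟩
  refine (norm_eq_iInf_iff_real_inner_le_zero hK hv).1 (le_antisymm ?_ ?_) w hw
  · exact le_ciInf fun y => hmin y y.2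
  · exact ciInf_le ⟨0, by rintro _ ⟨y, rfl⟩; exact norm_nonneg _⟩ (⟨v, hv⟩ : K)

/-- Quadratic growth, an error bound and sufficient decrease combine to a contraction. -/
theorem le_inv_mul_of_growth_of_decrease {a b d r C L κ : ℝ} (hb : 0 ≤ b) (hC : 0 < C)
    (hL : 0 < L) (hκ : 0 < κ) (hbound : b ≤ C * d * r) (hgrowth : κ / 2 * r ^ 2 ≤ b)
    (hdec : b ≤ a - L / 2 * d ^ 2) :
    b ≤ 1 / (1 + L * κ / (4 * C ^ 2)) * a := by
  have hkey : κ * b ≤ 2 * C ^ 2 * d ^ 2 := by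
    rcases hb.eq_or_lt with rfl | hpos
    · simp only [mul_zero]
      positivity
    · have h1 : b ^ 2 ≤ (C * d * r) ^ 2 := by gcongr
      have h2 : C ^ 2 * d ^ 2 * (κ / 2 * r ^ 2) ≤ C ^ 2 * d ^ 2 * b := by gcongr
      have h3 : κ / 2 * b ^ 2 ≤ κ / 2 * (C * d * r) ^ 2 := by gcongr
      refine le_of_mul_le_mul_right ?_ hpos
      linarith
  have h4 : L * (κ * b) ≤ L * (2 * C ^ 2 * d ^ 2) := by gcongr
  have h5 : 4 * C ^ 2 * b ≤ 4 * C ^ 2 * (a - L / 2 * d ^ 2) := by gcongr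
  have h6 : 1 + L * κ / (4 * C ^ 2) = (4 * C ^ 2 + L * κ) / (4 * C ^ 2) := by
    field_simp
  rw [h6, one_div_div, div_mul_eq_mul_div, le_div_iff₀ (by positivity)]
  linarith

/-- Linear convergence in function values of feasible descent methods under quadratic
functional growth (Theorem 14 / `the_fdm`). -/
theorem fdm_linear_convergence_quadratic_functional_growth
    {n : ℕ} (X Xstar : Set (EuclideanSpace ℝ (Fin n)))
    (f : EuclideanSpace ℝ (Fin n) → ℝ)
    (f' proj projX : EuclideanSpace ℝ (Fin n) → EuclideanSpace ℝ (Fin n))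
    (fstar Lf κ : ℝ)
    -- X is a nonempty closed convex set
    (hXne : X.Nonempty) (hXclosed : IsClosed X) (hXconv : Convex ℝ X)
    -- f is convex and continuously differentiable, with gradient f'
    (hconv : ConvexOn ℝ univ f)
    (hsmooth : ContDiff ℝ 1 f)
    (hgrad : ∀ x, HasGradientAt f (f' x) x)
    -- the gradient of f is Lipschitz continuous on X with constant Lf > 0
    (hLf : 0 < Lf)
    (hLip : ∀ x ∈ X, ∀ y ∈ X, ‖f' x - f' y‖ ≤ Lf * ‖x - y‖)
    -- Xstar is the (nonempty, closed) set of minimizers of f over X, with optimal value fstar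
    (hXstar : Xstar = {x ∈ X | ∀ y ∈ X, f x ≤ f y})
    (hXstar_ne : Xstar.Nonempty) (hXstar_closed : IsClosed Xstar)
    (hfstar : ∀ x ∈ Xstar, f x = fstar)
    -- proj is the Euclidean projection onto Xstar
    (hproj : ∀ x, proj x ∈ Xstar ∧ ∀ y ∈ Xstar, ‖x - proj x‖ ≤ ‖x - y‖)
    -- projX is the Euclidean projection onto X
    (hprojX : ∀ u, projX u ∈ X ∧ ∀ y ∈ X, ‖u - projX u‖ ≤ ‖u - y‖)
    (hκ : 0 < κ)
    -- f has quadratic functional growth on X with constant κ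
    (hqfg : ∀ x ∈ X, f x - fstar ≥ κ / 2 * ‖x - proj x‖ ^ 2)
    -- feasible descent method parameters
    (Lbar β L : ℝ) (hLbar : Lf ≤ Lbar) (hβ : 0 ≤ β) (hL : 0 < L)
    (x e : ℕ → EuclideanSpace ℝ (Fin n)) (α : ℕ → ℝ)
    (hx0 : x 0 ∈ X)
    (hα : ∀ k, 1 / Lbar ≤ α k)
    (hiter : ∀ k, x (k + 1) = projX (x k - α k • f' (x k) + e k))
    (herr : ∀ k, ‖e k‖ ≤ β * ‖x (k + 1) - x k‖)
    (hdescent : ∀ k, f (x (k + 1)) ≤ f (x k) - L / 2 * ‖x (k + 1) - x k‖ ^ 2) :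
    ∀ k : ℕ, f (x k) - fstar ≤
      (1 / (1 + L * κ / (4 * (Lf + Lbar + β * Lbar) ^ 2))) ^ k * (f (x 0) - fstar) := by
  have hmem : ∀ k, x k ∈ X
    | 0 => hx0
    | k + 1 => hiter k ▸ (hprojX _).1
  have hLbar_pos : 0 < Lbar := hLf.trans_le hLbar
  have hC : 0 < Lf + Lbar + β * Lbar := by positivity
  have hstep : ∀ k, f (x (k + 1)) - fstar ≤
      1 / (1 + L * κ / (4 * (Lf + Lbar + β * Lbar) ^ 2)) * (f (x k) - fstar) := by
    intro k
    have hp := (hproj (x (k + 1))).1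
    set y := x (k + 1) with hy
    set p := proj y
    have hpX : p ∈ X := by
      rw [hXstar] at hp
      exact hp.1
    have hyX : y ∈ X := hmem (k + 1)
    have hgrowth := hqfg y hyX
    refine le_inv_mul_of_growth_of_decrease (d := ‖y - x k‖) (r := ‖y - p‖)
      (le_trans (by positivity) hgrowth) hC hL hκ ?_ hgrowth (by linarith [hdescent k])
    have hα_pos : 0 < α k := lt_of_lt_of_le (by positivity) (hα k)
    have hvar : ⟪x k - α k • f' (x k) + e k - y, p - y⟫_ℝ ≤ 0 := by
      have hu := hprojX (x k - α k • f' (x k) + e k)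
      rw [← hiter k, ← hy] at hu
      exact hXconv.inner_sub_nearest_nonpos hyX hu.2 hpX
    have hgrad_step : ⟪f' (x k), y - p⟫_ℝ ≤ Lbar * ((1 + β) * ‖y - x k‖ * ‖y - p‖) := by
      have hsplit : α k * ⟪f' (x k), y - p⟫_ℝ =
          ⟪x k - α k • f' (x k) + e k - y, p - y⟫_ℝ + ⟪x k - y + e k, y - p⟫_ℝ := by
        rw [← neg_sub y p, inner_neg_right, ← real_inner_smul_left, neg_add_eq_sub,
          ← inner_sub_left]
        congr 1
        abel
      have hcs : ⟪x k - y + e k, y - p⟫_ℝ ≤ (1 + β) * ‖y - x k‖ * ‖y - p‖ := by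
        refine (real_inner_le_norm _ _).trans ?_
        gcongr
        calc ‖x k - y + e k‖ ≤ ‖x k - y‖ + ‖e k‖ := norm_add_le _ _
          _ ≤ (1 + β) * ‖y - x k‖ := by
            rw [norm_sub_rev]
            linarith [herr k]
      have hone : 1 ≤ Lbar * α k := (div_le_iff₀' hLbar_pos).1 (hα k)
      refine le_of_mul_le_mul_left ?_ hα_pos
      have : 0 ≤ (1 + β) * ‖y - x k‖ * ‖y - p‖ := by positivity
      nlinarith
    have hgrad_diff : ⟪f' y - f' (x k), y - p⟫_ℝ ≤ Lf * ‖y - x k‖ * ‖y - p‖ :=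
      (real_inner_le_norm _ _).trans (by gcongr; exact hLip y hyX _ (hmem k))
    have hfirst := hconv.add_inner_gradient_le (hgrad y) p
    rw [hfstar p hp, ← neg_sub y p, inner_neg_right] at hfirst
    rw [inner_sub_left] at hgrad_diff
    linarith
  intro k
  induction k with
  | zero => simp
  | succ k ih =>
    rw [pow_succ', mul_assoc]
    exact (hstep k).trans (by gcongr)
end
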